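/- arXiv:1707.08872 — 3 statements merged into one kernel-verified Lean document; each statement's English description precedes it below -/
import Mathlib

section
/- Let n, m, k be positive integers and let A be an n×m matrix, B an n×k matrix, and C a k×m matrix, all with nonnegative real entries. If the subtropical product B⊠C is dominated by A, i.e. (B⊠C)_{ij} ≤ A_{ij} for all i ∈ {1,…,n} and j ∈ {1,…,m}, then s(B) + s(C) ≥ s(A). -/
open scoped NNReal

/-- Number of nonzero entries of a matrix. -/
noncomputable def nnz {n m : ℕ} (X : Matrix (Fin n) (Fin m) ℝ≥0) : ℕ :=
  (Finset.univ.filter fun p : Fin n × Fin m => X p.1 p.2 ≠ 0).card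

/-- Sparsity of a matrix: fraction of zero entries. -/
noncomputable def sparsity {n m : ℕ} (X : Matrix (Fin n) (Fin m) ℝ≥0) : ℝ :=
  ((n * m : ℝ) - nnz X) / (n * m)

lemma nnz_cols {n m : ℕ} (X : Matrix (Fin n) (Fin m) ℝ≥0) :
    nnz X = ∑ j, (Finset.univ.filter fun i => X i j ≠ 0).card := by
  unfold nnz
  simp only [Finset.card_filter]
  rw [Fintype.sum_prod_type_right]

lemma nnz_rows {n m : ℕ} (X : Matrix (Fin n) (Fin m) ℝ≥0) :
    nnz X = ∑ i, (Finset.univ.filter fun j => X i j ≠ 0).card := by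
  unfold nnz
  simp only [Finset.card_filter]
  rw [Fintype.sum_prod_type]

theorem subtropical_dominated_sparsity (n m k : ℕ) (hn : 0 < n) (hm : 0 < m) (hk : 0 < k)
    (A : Matrix (Fin n) (Fin m) ℝ≥0) (B : Matrix (Fin n) (Fin k) ℝ≥0)
    (C : Matrix (Fin k) (Fin m) ℝ≥0)
    (hdom : ∀ i j, (Finset.univ.sup fun s => B i s * C s j) ≤ A i j) :
    sparsity A ≤ sparsity B + sparsity C := by
  have key : ∀ s : Fin k, ((Finset.univ.filter fun i => B i s ≠ 0).card : ℝ) * m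
      + n * ((Finset.univ.filter fun j => C s j ≠ 0).card : ℝ) ≤ n * m + nnz A := by
    intro s
    have h1 : (Finset.univ.filter fun i => B i s ≠ 0).card
        * (Finset.univ.filter fun j => C s j ≠ 0).card ≤ nnz A := by
      rw [← Finset.card_product]
      apply Finset.card_le_card
      intro p hp
      simp only [Finset.mem_product, Finset.mem_filter, Finset.mem_univ, true_and] at hp ⊢
      have h2 : B p.1 s * C s p.2 ≤ A p.1 p.2 :=
        (Finset.le_sup (f := fun s => B p.1 s * C s p.2) (Finset.mem_univ s)).trans
          (hdom p.1 p.2)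
      intro h0
      rw [h0] at h2
      exact mul_ne_zero hp.1 hp.2 (le_antisymm h2 zero_le)
    have hb : (Finset.univ.filter fun i => B i s ≠ 0).card ≤ n := by
      simpa using Finset.card_le_univ (Finset.univ.filter fun i => B i s ≠ 0)
    have hc : (Finset.univ.filter fun j => C s j ≠ 0).card ≤ m := by
      simpa using Finset.card_le_univ (Finset.univ.filter fun j => C s j ≠ 0)
    generalize (Finset.univ.filter fun i => B i s ≠ 0).card = b at *
    generalize (Finset.univ.filter fun j => C s j ≠ 0).card = c at *
    have h1' : (b : ℝ) * c ≤ nnz A := by exact_mod_cast h1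
    have hb' : (b : ℝ) ≤ n := by exact_mod_cast hb
    have hc' : (c : ℝ) ≤ m := by exact_mod_cast hc
    nlinarith [mul_nonneg (sub_nonneg.2 hb') (sub_nonneg.2 hc')]
  have hs := Finset.sum_le_sum (fun s (_ : s ∈ Finset.univ) => key s)
  rw [Finset.sum_add_distrib, ← Finset.sum_mul, ← Finset.mul_sum, ← Nat.cast_sum,
    ← Nat.cast_sum, ← nnz_cols, ← nnz_rows] at hs
  simp only [Finset.sum_const, Finset.card_univ, Fintype.card_fin, nsmul_eq_mul] at hs
  have hn' : (0 : ℝ) < n := by exact_mod_cast hn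
  have hm' : (0 : ℝ) < m := by exact_mod_cast hm
  have hk' : (0 : ℝ) < k := by exact_mod_cast hk
  unfold sparsity
  have e : ((n * k : ℝ) - nnz B) / (n * k) + ((k * m : ℝ) - nnz C) / (k * m)
      - ((n * m : ℝ) - nnz A) / (n * m)
      = (k * (n * m + nnz A) - (nnz B * m + n * nnz C)) / (n * m * k) := by
    field_simp
    ring
  have : 0 ≤ (k * (n * m + nnz A) - (nnz B * m + n * nnz C) : ℝ) / (n * m * k) :=
    div_nonneg (by linarith) (by positivity)
  linarith
end

section
/- Let A be an n×m matrix all of whose entries lie in {0,1}. Then the Boolean rank of A equals the subtropical Schein/Barvinok rank of A: the least k for which there exist binary matrices B ∈ {0,1}^{n×k} and C ∈ {0,1}^{k×m} with A equal to the Boolean product of B and C is the same as the least k for which there exist nonnegative real matrices B ∈ ℝ≥0^{n×k} and C ∈ ℝ≥0^{k×m} with A = B⊠C. -/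
open scoped NNReal

theorem boolean_rank_eq_subtropical_rank_of_binary (n m : ℕ)
    (A : Matrix (Fin n) (Fin m) ℝ≥0)
    (hbin : ∀ i j, A i j = 0 ∨ A i j = 1) :
    sInf {k : ℕ | ∃ (B : Matrix (Fin n) (Fin k) Bool) (C : Matrix (Fin k) (Fin m) Bool),
        ∀ i j, A i j = 1 ↔ ∃ l, B i l = true ∧ C l j = true} =
    sInf {k : ℕ | ∃ (B : Matrix (Fin n) (Fin k) ℝ≥0) (C : Matrix (Fin k) (Fin m) ℝ≥0),
        ∀ i j, A i j = Finset.univ.sup fun l => B i l * C l j} := by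
  have key : ∀ {k : ℕ} (f : Fin k → ℝ≥0), Finset.univ.sup f = 0 ↔ ∀ l, f l = 0 := by
    intro k f
    rw [← bot_eq_zero, Finset.sup_eq_bot_iff]
    simp
  congr 1
  ext k
  simp only [Set.mem_ofPred_eq]
  constructor
  · rintro ⟨B, C, h⟩
    refine ⟨fun i l => if B i l = true then 1 else 0,
      fun l j => if C l j = true then 1 else 0, fun i j => ?_⟩
    rcases hbin i j with h0 | h1
    · rw [h0, eq_comm, key]
      intro l
      have hn : ¬ ∃ l, B i l = true ∧ C l j = true := by
        rw [← h i j, h0]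
        exact zero_ne_one
      by_cases hb : B i l = true
      · have hc : ¬ C l j = true := fun hc => hn ⟨l, hb, hc⟩
        simp [hc]
      · simp [hb]
    · rw [h1]
      obtain ⟨l, hb, hc⟩ := (h i j).1 h1
      apply le_antisymm
      · refine le_trans ?_ (Finset.le_sup (Finset.mem_univ l))
        simp [hb, hc]
      · apply Finset.sup_le
        intro l _
        beta_reduce
        split_ifs <;> simp
  · rintro ⟨B, C, h⟩
    refine ⟨fun i l => decide (B i l ≠ 0), fun l j => decide (C l j ≠ 0), fun i j => ?_⟩
    have h2 : A i j = 1 ↔ ¬ A i j = 0 := by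
      rcases hbin i j with h0 | h1
      · simp [h0]
      · simp [h1]
    rw [h2, h i j, key]
    simp [not_or]
end

section
/- Let n, m, k be positive integers, let A ∈ ℝ^{n×m}, B ∈ ℝ^{n×k}, C ∈ ℝ^{k×m} be real matrices, and let λ ≥ 0. Define α_{ij} = max_{d=1,…,k}(B_{id} + C_{dj}), N = max over all i ∈ {1,…,n}, j ∈ {1,…,m} of max(A_{ij}, α_{ij}), and M = exp(N). If Σ_{i,j}(A_{ij} − α_{ij})² ≤ λ, then Σ_{i,j}(exp(A_{ij}) − max_{d=1,…,k} exp(B_{id})·exp(C_{dj}))² ≤ M²·λ. -/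
theorem exp_sq_aux (N x y : ℝ) (hx : x ≤ N) (hyx : y ≤ x) :
    (Real.exp x - Real.exp y) ^ 2 ≤ Real.exp N ^ 2 * (x - y) ^ 2 := by
  have h1 : Real.exp y = Real.exp x * Real.exp (y - x) := by
    rw [← Real.exp_add]; congr 1; ring
  have h2 := Real.add_one_le_exp (y - x)
  have h3 : Real.exp y ≤ Real.exp x := Real.exp_le_exp.2 hyx
  have h4 : Real.exp x ≤ Real.exp N := Real.exp_le_exp.2 hx
  have h5 := Real.exp_pos x
  rw [← mul_pow]
  apply pow_le_pow_left₀ (by linarith)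
  have h6 : Real.exp x * (x - y) ≤ Real.exp N * (x - y) :=
    mul_le_mul_of_nonneg_right h4 (by linarith)
  have h7 := mul_le_mul_of_nonneg_left h2 h5.le
  rw [← h1] at h7
  linarith

theorem exp_sq_aux2 (N x y : ℝ) (hx : x ≤ N) (hy : y ≤ N) :
    (Real.exp x - Real.exp y) ^ 2 ≤ Real.exp N ^ 2 * (x - y) ^ 2 := by
  rcases le_total y x with h | h
  · exact exp_sq_aux N x y hx h
  · have := exp_sq_aux N y x hy h
    rw [sub_sq_comm, sub_sq_comm x y]
    exact this

theorem tropical_to_subtropical_error_bound (n m k : ℕ)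
    (hn : 0 < n) (hm : 0 < m) (hk : 0 < k)
    (A : Matrix (Fin n) (Fin m) ℝ) (B : Matrix (Fin n) (Fin k) ℝ)
    (C : Matrix (Fin k) (Fin m) ℝ)
    (lam : ℝ) (hlam : 0 ≤ lam)
    (α : Fin n → Fin m → ℝ)
    (hα : ∀ i j, α i j =
      Finset.univ.sup' ⟨⟨0, hk⟩, Finset.mem_univ _⟩ fun d => B i d + C d j)
    (N M : ℝ)
    (hN : N = Finset.univ.sup' ⟨(⟨0, hn⟩, ⟨0, hm⟩), Finset.mem_univ _⟩
      fun p : Fin n × Fin m => max (A p.1 p.2) (α p.1 p.2))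
    (hM : M = Real.exp N)
    (herr : ∑ i, ∑ j, (A i j - α i j) ^ 2 ≤ lam) :
    ∑ i, ∑ j, (Real.exp (A i j) -
        Finset.univ.sup' ⟨⟨0, hk⟩, Finset.mem_univ _⟩
          (fun d => Real.exp (B i d) * Real.exp (C d j))) ^ 2 ≤ M ^ 2 * lam := by
  have key : ∀ i j, Finset.univ.sup' ⟨⟨0, hk⟩, Finset.mem_univ _⟩
      (fun d => Real.exp (B i d) * Real.exp (C d j)) = Real.exp (α i j) := by
    intro i j
    rw [hα]
    simp only [← Real.exp_add]
    exact (Finset.comp_sup'_eq_sup'_comp _ Real.exp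
      (fun x y => Real.exp_monotone.map_sup x y)).symm
  have hle : ∀ i j, max (A i j) (α i j) ≤ N := by
    intro i j
    rw [hN]
    exact Finset.le_sup' (fun p : Fin n × Fin m => max (A p.1 p.2) (α p.1 p.2))
      (Finset.mem_univ (i, j))
  simp only [key]
  refine le_trans ?_ (mul_le_mul_of_nonneg_left herr (sq_nonneg M))
  simp only [Finset.mul_sum]
  refine Finset.sum_le_sum fun i _ => Finset.sum_le_sum fun j _ => ?_
  rw [hM]
  exact exp_sq_aux2 N _ _ ((le_max_left _ _).trans (hle i j)) ((le_max_right _ _).trans (hle i j))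
end
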